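/- (Key Lemma 3.2.) Let (x, y) be a generalized PL metric on the star triangulation of an n-gon (n ≥ 3) which is Delaunay. Let w₀ ∈ ℝ and w : ℤ/nℤ → ℝ be such that: (a) the vertex-scaled lengths (x_i(w), x_{i+1}(w), y_i(w)) satisfy the weak triangle inequalities for every i and the scaled metric is Delaunay; (b) α(w) ≥ α(0); (c) w₀ ≥ w_i for all i; and suppose there exists i₀ ∈ ℤ/nℤ with w_{i₀} < w₀. Then there exists ŵ : ℤ/nℤ → ℝ such that: (i) ŵ_i ≥ w_i for all i; (ii) ŵ_i ≤ w₀ for all i; (iii) with the same value w₀ at v₀, the metric scaled by (w₀, ŵ) satisfies the weak triangle inequalities in every triangle and is Delaunay; and (iv) α(ŵ) > α(w) (cone angles at v₀ taken with the common value w₀ at v₀). -/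

import Mathlib

open Real

/-- The inner angle opposite the side of length `r` in a generalized triangle with
side lengths `p`, `q`, `r` (law of cosines). -/
noncomputable def triAngle (p q r : ℝ) : ℝ :=
  Real.arccos ((p ^ 2 + q ^ 2 - r ^ 2) / (2 * p * q))

/-- Positive reals `p, q, r` satisfying the weak triangle inequalities
(a generalized triangle). -/
def IsGenTri (p q r : ℝ) : Prop :=
  0 < p ∧ 0 < q ∧ 0 < r ∧ p ≤ q + r ∧ q ≤ p + r ∧ r ≤ p + q

/-! Star triangulation of an `n`-gon: interior vertex `v₀`, boundary vertices
`vᵢ, i ∈ ℤ/nℤ`, triangles `Δ v₀ vᵢ v_{i+1}`; `x i` is the length of `v₀vᵢ` and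
`y i` the length of `vᵢv_{i+1}`.  Conformal factors: `w0` at `v₀`, `w i` at `vᵢ`. -/

/-- Scaled length of the edge `v₀ vᵢ`. -/
noncomputable def Xl (n : ℕ) (x : ZMod n → ℝ) (w0 : ℝ) (w : ZMod n → ℝ) (i : ZMod n) : ℝ :=
  Real.exp (w0 + w i) * x i

/-- Scaled length of the edge `vᵢ v_{i+1}`. -/
noncomputable def Yl (n : ℕ) (y : ZMod n → ℝ) (w : ZMod n → ℝ) (i : ZMod n) : ℝ :=
  Real.exp (w i + w (i + 1)) * y i

/-- The angle `cᵢ(w)` at `v₀` in the triangle `Δ v₀ vᵢ v_{i+1}` in the scaled metric. -/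
noncomputable def cAng (n : ℕ) (x y : ZMod n → ℝ) (w0 : ℝ) (w : ZMod n → ℝ) (i : ZMod n) : ℝ :=
  triAngle (Xl n x w0 w i) (Xl n x w0 w (i + 1)) (Yl n y w i)

/-- The angle `aᵢ(w)` at `v_{i+1}` in the triangle `Δ v₀ vᵢ v_{i+1}` in the scaled metric. -/
noncomputable def aAng (n : ℕ) (x y : ZMod n → ℝ) (w0 : ℝ) (w : ZMod n → ℝ) (i : ZMod n) : ℝ :=
  triAngle (Xl n x w0 w (i + 1)) (Yl n y w i) (Xl n x w0 w i)

/-- The angle `bᵢ(w)` at `v_{i-1}` in the triangle `Δ v₀ v_{i-1} vᵢ` in the scaled metric. -/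
noncomputable def bAng (n : ℕ) (x y : ZMod n → ℝ) (w0 : ℝ) (w : ZMod n → ℝ) (i : ZMod n) : ℝ :=
  triAngle (Xl n x w0 w (i - 1)) (Yl n y w (i - 1)) (Xl n x w0 w i)

/-- The cone angle `α(w)` at the interior vertex `v₀` of the scaled metric. -/
noncomputable def coneAngle (n : ℕ) [NeZero n] (x y : ZMod n → ℝ) (w0 : ℝ)
    (w : ZMod n → ℝ) : ℝ :=
  ∑ i : ZMod n, cAng n x y w0 w i

/-! The triangle `Δ v₀ vᵢ v_{i+1}` with lengths `Xᵢ, X_{i+1}, Yᵢ` is similar to the one with lengths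
`r_{i+1}, rᵢ, Lᵢ`, where `rᵢ = exp (w₀ - wᵢ) / xᵢ` and `Lᵢ = yᵢ / (xᵢ x_{i+1})`
does not depend on the conformal factor.  In these inverted lengths the Delaunay condition says that the
boundary polygon is convex at each vertex, which is a linear inequality in the squares `rᵢ ^ 2`. -/

lemma triAngle_mul {k : ℝ} (hk : k ≠ 0) (p q r : ℝ) :
    triAngle (k * p) (k * q) (k * r) = triAngle p q r := by
  unfold triAngle
  congr 1
  rw [show (k * p) ^ 2 + (k * q) ^ 2 - (k * r) ^ 2 = k ^ 2 * (p ^ 2 + q ^ 2 - r ^ 2) by ring,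
    show 2 * (k * p) * (k * q) = k ^ 2 * (2 * p * q) by ring,
    mul_div_mul_left _ _ (pow_ne_zero 2 hk)]

lemma triAngle_comm (p q r : ℝ) : triAngle p q r = triAngle q p r := by
  unfold triAngle
  congr 1
  ring

lemma IsGenTri.swap {p q r : ℝ} (h : IsGenTri p q r) : IsGenTri q p r := by
  obtain ⟨h1, h2, h3, h4, h5, h6⟩ := h
  exact ⟨h2, h1, h3, h5, h4, by linarith⟩

lemma IsGenTri.rotate {p q r : ℝ} (h : IsGenTri p q r) : IsGenTri q r p := by
  obtain ⟨h1, h2, h3, h4, h5, h6⟩ := h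
  exact ⟨h2, h3, h1, by linarith, by linarith, by linarith⟩

lemma isGenTri_mul_iff {k : ℝ} (hk : 0 < k) (p q r : ℝ) :
    IsGenTri (k * p) (k * q) (k * r) ↔ IsGenTri p q r := by
  simp only [IsGenTri, mul_pos_iff_of_pos_left hk, ← mul_add, mul_le_mul_iff_right₀ hk]

lemma IsGenTri.cos_mem_Icc {p q r : ℝ} (h : IsGenTri p q r) :
    (p ^ 2 + q ^ 2 - r ^ 2) / (2 * p * q) ∈ Set.Icc (-1 : ℝ) 1 := by
  obtain ⟨h1, h2, h3, h4, h5, h6⟩ := h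
  constructor
  · rw [le_div_iff₀ (by positivity)]
    nlinarith
  · rw [div_le_iff₀ (by positivity)]
    nlinarith

/-- Two adjacent angles at a vertex at distance `p` from the centre sum to at most `π` iff the sum
of their cosines, here multiplied by `2 p`, is nonnegative. -/
lemma triAngle_add_le_pi_iff {p l₁ q₁ l₂ q₂ : ℝ} (h₁ : IsGenTri p l₁ q₁) (h₂ : IsGenTri p l₂ q₂) :
    triAngle p l₁ q₁ + triAngle p l₂ q₂ ≤ π ↔
      0 ≤ (p ^ 2 + l₁ ^ 2 - q₁ ^ 2) / l₁ + (p ^ 2 + l₂ ^ 2 - q₂ ^ 2) / l₂ := by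
  have c₁ := h₁.cos_mem_Icc
  have c₂ := h₂.cos_mem_Icc
  obtain ⟨hp, hl₁, -⟩ := h₁
  obtain ⟨-, hl₂, -⟩ := h₂
  rw [show (p ^ 2 + l₁ ^ 2 - q₁ ^ 2) / l₁ + (p ^ 2 + l₂ ^ 2 - q₂ ^ 2) / l₂ =
    2 * p * ((p ^ 2 + l₁ ^ 2 - q₁ ^ 2) / (2 * p * l₁) +
      (p ^ 2 + l₂ ^ 2 - q₂ ^ 2) / (2 * p * l₂)) by field_simp,
    mul_nonneg_iff_of_pos_left (by positivity)]
  unfold triAngle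
  generalize (p ^ 2 + l₁ ^ 2 - q₁ ^ 2) / (2 * p * l₁) = u at *
  generalize (p ^ 2 + l₂ ^ 2 - q₂ ^ 2) / (2 * p * l₂) = v at *
  rw [← le_sub_iff_add_le, ← Real.arccos_neg,
    Real.strictAntiOn_arccos.le_iff_ge c₁ ⟨by linarith [c₂.2], by linarith [c₂.1]⟩]
  constructor <;> intro h <;> linarith

lemma div_sqrt_one_sub_sq_add_pos {u v : ℝ} (hu : u ∈ Set.Ioo (-1 : ℝ) 1)
    (hv : v ∈ Set.Ioo (-1 : ℝ) 1) (huv : 0 < u + v) :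
    0 < u / √(1 - u ^ 2) + v / √(1 - v ^ 2) := by
  rw [← Real.tan_arcsin, ← Real.tan_arcsin]
  have h : Real.tan (Real.arcsin (-v)) < Real.tan (Real.arcsin u) := by
    apply Real.tan_lt_tan_of_lt_of_lt_pi_div_two
    · rw [Real.neg_pi_div_two_lt_arcsin]
      linarith [hv.2]
    · rw [Real.arcsin_lt_pi_div_two]
      exact hu.2
    · apply Real.strictMonoOn_arcsin ⟨by linarith [hv.2], by linarith [hv.1]⟩ ⟨hu.1.le, hu.2.le⟩
      linarith
  rw [Real.arcsin_neg, Real.tan_neg] at h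
  linarith

lemma cos_mem_Ioo_of_lt {p q l : ℝ} (hp : 0 < p) (hl : 0 < l) (hq : 0 < q)
    (h₁ : p < q + l) (h₂ : q < p + l) (h₃ : l < p + q) :
    (p ^ 2 + l ^ 2 - q ^ 2) / (2 * p * l) ∈ Set.Ioo (-1 : ℝ) 1 := by
  constructor
  · rw [lt_div_iff₀ (by positivity)]
    nlinarith
  · rw [div_lt_iff₀ (by positivity)]
    nlinarith

/-- With two sides fixed, the derivative of an angle with respect to an adjacent side `p` is
`-cot A / p`, where `A` is the other angle adjacent to `p`. -/
lemma hasDerivAt_triAngle {p q l : ℝ} (hp : 0 < p) (hl : 0 < l) (hq : 0 < q)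
    (h₁ : p < q + l) (h₂ : q < p + l) (h₃ : l < p + q) :
    HasDerivAt (fun t => triAngle t q l)
      (-(((p ^ 2 + l ^ 2 - q ^ 2) / (2 * p * l)) /
        √(1 - ((p ^ 2 + l ^ 2 - q ^ 2) / (2 * p * l)) ^ 2)) / p) p := by
  have hc := cos_mem_Ioo_of_lt hp hq hl (by linarith) (by linarith) (by linarith)
  have hA := cos_mem_Ioo_of_lt hp hl hq h₁ h₂ h₃
  have hd : HasDerivAt (fun t : ℝ => (t ^ 2 + q ^ 2 - l ^ 2) / (2 * t * q))
      ((p ^ 2 + l ^ 2 - q ^ 2) / (2 * p ^ 2 * q)) p := by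
    have h := ((((hasDerivAt_id p).pow 2).add_const (q ^ 2)).sub_const (l ^ 2)).div
      (((hasDerivAt_id p).const_mul 2).mul_const q) (by simp; exact ⟨hp.ne', hq.ne'⟩)
    refine h.congr_deriv ?_
    simp
    field_simp
    ring
  refine ((Real.hasDerivAt_arccos hc.1.ne' hc.2.ne).comp p hd).congr_deriv ?_
  have key : √(1 - ((p ^ 2 + q ^ 2 - l ^ 2) / (2 * p * q)) ^ 2) =
      l / q * √(1 - ((p ^ 2 + l ^ 2 - q ^ 2) / (2 * p * l)) ^ 2) := by
    rw [← Real.sqrt_sq (show 0 ≤ l / q by positivity), ← Real.sqrt_mul (by positivity)]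
    congr 1
    field_simp
    ring
  have hs : 0 < √(1 - ((p ^ 2 + l ^ 2 - q ^ 2) / (2 * p * l)) ^ 2) := by
    apply Real.sqrt_pos.2
    nlinarith [hA.1, hA.2]
  rw [key]
  generalize √(1 - ((p ^ 2 + l ^ 2 - q ^ 2) / (2 * p * l)) ^ 2) = S at *
  field_simp

lemma continuousOn_triAngle {q l a b : ℝ} (ha : 0 < a) (hq : 0 < q) :
    ContinuousOn (fun t => triAngle t q l) (Set.Icc a b) := by
  unfold triAngle
  refine Real.continuous_arccos.comp_continuousOn (ContinuousOn.div (by fun_prop) (by fun_prop) ?_)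
  intro t ht
  have : 0 < t := ha.trans_le ht.1
  positivity

/-- Shortening the spoke shared by two adjacent triangles, while the polygon is strictly convex
at its end, strictly increases the total angle at the centre. -/
lemma triAngle_add_lt_of_shorten {a b q₁ l₁ q₂ l₂ : ℝ} (ha : 0 < a) (hab : a < b)
    (hq₁ : 0 < q₁) (hl₁ : 0 < l₁) (hq₂ : 0 < q₂) (hl₂ : 0 < l₂)
    (hb₁ : b ≤ q₁ + l₁) (hb₂ : b ≤ q₂ + l₂)
    (hA₁ : q₁ < a + l₁) (hA₂ : q₂ < a + l₂) (hc₁ : l₁ < a + q₁) (hc₂ : l₂ < a + q₂)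
    (hconv : 0 < (a ^ 2 + l₁ ^ 2 - q₁ ^ 2) / l₁ + (a ^ 2 + l₂ ^ 2 - q₂ ^ 2) / l₂) :
    triAngle b q₁ l₁ + triAngle b q₂ l₂ < triAngle a q₁ l₁ + triAngle a q₂ l₂ := by
  have hanti : StrictAntiOn (fun t => triAngle t q₁ l₁ + triAngle t q₂ l₂) (Set.Icc a b) := by
    refine strictAntiOn_of_deriv_neg (convex_Icc a b)
      ((continuousOn_triAngle ha hq₁).add (continuousOn_triAngle ha hq₂)) ?_
    intro p hp
    rw [interior_Icc] at hp
    obtain ⟨hap, hpb⟩ := hp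
    have hp : 0 < p := ha.trans hap
    have h₁ : p < q₁ + l₁ := by linarith
    have h₂ : p < q₂ + l₂ := by linarith
    have d₁ := hasDerivAt_triAngle hp hl₁ hq₁ h₁ (by linarith) (by linarith)
    have d₂ := hasDerivAt_triAngle hp hl₂ hq₂ h₂ (by linarith) (by linarith)
    have hcos := div_sqrt_one_sub_sq_add_pos
      (cos_mem_Ioo_of_lt hp hl₁ hq₁ h₁ (by linarith) (by linarith))
      (cos_mem_Ioo_of_lt hp hl₂ hq₂ h₂ (by linarith) (by linarith)) (by
        have : 0 < (p ^ 2 + l₁ ^ 2 - q₁ ^ 2) / l₁ + (p ^ 2 + l₂ ^ 2 - q₂ ^ 2) / l₂ :=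
          hconv.trans_le (by gcongr)
        rw [show (p ^ 2 + l₁ ^ 2 - q₁ ^ 2) / (2 * p * l₁) + (p ^ 2 + l₂ ^ 2 - q₂ ^ 2) / (2 * p * l₂) =
          ((p ^ 2 + l₁ ^ 2 - q₁ ^ 2) / l₁ + (p ^ 2 + l₂ ^ 2 - q₂ ^ 2) / l₂) / (2 * p) by field_simp]
        positivity)
    rw [(d₁.fun_add d₂).deriv, ← add_div]
    apply div_neg_of_neg_of_pos _ hp
    linarith
  exact hanti (Set.left_mem_Icc.2 hab.le) (Set.right_mem_Icc.2 hab.le) hab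

/-- A positive multiple of the sum of the cosines of the two boundary angles at the `j`-th vertex of
a star with spokes `r` and boundary edges `L`. -/
noncomputable def starConvexity {n : ℕ} (L r : ZMod n → ℝ) (j : ZMod n) : ℝ :=
  (r j ^ 2 + L j ^ 2 - r (j + 1) ^ 2) / L j + (r j ^ 2 + L (j - 1) ^ 2 - r (j - 1) ^ 2) / L (j - 1)

/-- Discrete maximum principle for the squared spoke lengths. -/
lemma exists_lt_and_starConvexity_pos {n : ℕ} [NeZero n] {L r ρ : ZMod n → ℝ}
    (hL : ∀ i, 0 < L i) (hρ : ∀ i, 0 < ρ i) (hρr : ∀ i, ρ i ≤ r i)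
    (hconv : ∀ i, 0 ≤ starConvexity L ρ i) (hlt : ∃ i, ρ i < r i) :
    ∃ i, ρ i < r i ∧ 0 < starConvexity L r i := by
  by_contra! hcon
  obtain ⟨m, hm⟩ := Finite.exists_max (fun i => r i ^ 2 - ρ i ^ 2)
  obtain ⟨i₀, hi₀⟩ := hlt
  have hpos : 0 < r m ^ 2 - ρ m ^ 2 := by
    have := hm i₀
    nlinarith [hρ i₀]
  have hlt_of_eq : ∀ j, r j ^ 2 - ρ j ^ 2 = r m ^ 2 - ρ m ^ 2 → ρ j < r j := by
    intro j hj
    nlinarith [hρ j, hρr j]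
  have hstep : ∀ k : ℕ, r (m + k) ^ 2 - ρ (m + k) ^ 2 = r m ^ 2 - ρ m ^ 2 := by
    intro k
    induction k with
    | zero => simp
    | succ k ih =>
      push_cast
      rw [← add_assoc]
      generalize m + (k : ZMod n) = j at *
      have h₁ := hcon j (hlt_of_eq j ih)
      have h₂ := hconv j
      unfold starConvexity at h₁ h₂
      have hn : 0 ≤ ((r j ^ 2 - ρ j ^ 2) - (r (j - 1) ^ 2 - ρ (j - 1) ^ 2)) / L (j - 1) :=
        div_nonneg (by linarith [hm (j - 1)]) (hL _).le
      have hle : ((r j ^ 2 - ρ j ^ 2) - (r (j + 1) ^ 2 - ρ (j + 1) ^ 2)) / L j ≤ 0 := by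
        have e : ((r j ^ 2 - ρ j ^ 2) - (r (j + 1) ^ 2 - ρ (j + 1) ^ 2)) / L j +
            ((r j ^ 2 - ρ j ^ 2) - (r (j - 1) ^ 2 - ρ (j - 1) ^ 2)) / L (j - 1) =
            ((r j ^ 2 + L j ^ 2 - r (j + 1) ^ 2) / L j +
              (r j ^ 2 + L (j - 1) ^ 2 - r (j - 1) ^ 2) / L (j - 1)) -
            ((ρ j ^ 2 + L j ^ 2 - ρ (j + 1) ^ 2) / L j +
              (ρ j ^ 2 + L (j - 1) ^ 2 - ρ (j - 1) ^ 2) / L (j - 1)) := by ring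
        linarith
      rw [div_le_iff₀ (hL j)] at hle
      linarith [hm (j + 1)]
  have hall : ∀ j, ρ j < r j := by
    intro j
    have h := hstep (j - m).val
    rw [ZMod.natCast_zmod_val, add_sub_cancel] at h
    exact hlt_of_eq j h
  obtain ⟨M, hM⟩ := Finite.exists_max r
  have h := hcon M (hall M)
  have hsq : ∀ j, r j ^ 2 ≤ r M ^ 2 := fun j =>
    pow_le_pow_left₀ ((hρ j).le.trans (hρr j)) (hM j) 2
  have hterm : ∀ j l, 0 < l → 0 < (r M ^ 2 + l ^ 2 - r j ^ 2) / l := fun j l hl =>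
    div_pos (by nlinarith [hsq j]) hl
  unfold starConvexity at h
  linarith [hterm (M + 1) (L M) (hL _), hterm (M - 1) (L (M - 1)) (hL _)]

lemma exists_shorter_spoke {b c q₁ l₁ q₂ l₂ : ℝ} (hcb : c < b)
    (hA₁ : q₁ < b + l₁) (hA₂ : q₂ < b + l₂) (hc₁ : l₁ < b + q₁) (hc₂ : l₂ < b + q₂)
    (hconv : 0 < (b ^ 2 + l₁ ^ 2 - q₁ ^ 2) / l₁ + (b ^ 2 + l₂ ^ 2 - q₂ ^ 2) / l₂) :
    ∃ a, c < a ∧ a < b ∧ q₁ < a + l₁ ∧ q₂ < a + l₂ ∧ l₁ < a + q₁ ∧ l₂ < a + q₂ ∧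
      0 < (a ^ 2 + l₁ ^ 2 - q₁ ^ 2) / l₁ + (a ^ 2 + l₂ ^ 2 - q₂ ^ 2) / l₂ := by
  have hev : ∀ᶠ a in nhds b, c < a ∧ q₁ < a + l₁ ∧ q₂ < a + l₂ ∧ l₁ < a + q₁ ∧ l₂ < a + q₂ ∧
      0 < (a ^ 2 + l₁ ^ 2 - q₁ ^ 2) / l₁ + (a ^ 2 + l₂ ^ 2 - q₂ ^ 2) / l₂ := by
    have lt_near : ∀ {f : ℝ → ℝ} {d : ℝ}, Continuous f → d < f b → ∀ᶠ a in nhds b, d < f a :=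
      fun hf h => hf.continuousAt.eventually_const_lt h
    exact (lt_near continuous_id hcb).and <| (lt_near (by fun_prop) hA₁).and <|
      (lt_near (by fun_prop) hA₂).and <| (lt_near (by fun_prop) hc₁).and <|
      (lt_near (by fun_prop) hc₂).and (lt_near (by fun_prop) hconv)
  obtain ⟨l, hl, hsub⟩ := exists_Ioc_subset_of_mem_nhds hev ⟨c, hcb⟩
  obtain ⟨a, hla, hab⟩ := exists_between hl
  obtain ⟨h₁, h⟩ := hsub ⟨hla, hab.le⟩
  exact ⟨a, h₁, hab, h⟩

/-- The key lemma in inverted lengths: among convex stars with prescribed boundary edges, one that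
dominates another can be shrunk so that the cone angle increases. -/
lemma exists_shorter_star_coneAngle_lt {n : ℕ} [NeZero n] (hn : 3 ≤ n) {L r ρ : ZMod n → ℝ}
    (hρ : ∀ i, IsGenTri (ρ i) (ρ (i + 1)) (L i)) (hr : ∀ i, IsGenTri (r i) (r (i + 1)) (L i))
    (hρr : ∀ i, ρ i ≤ r i) (hρconv : ∀ i, 0 ≤ starConvexity L ρ i)
    (hrconv : ∀ i, 0 ≤ starConvexity L r i) (hlt : ∃ i, ρ i < r i) :
    ∃ s : ZMod n → ℝ, (∀ i, ρ i ≤ s i) ∧ (∀ i, s i ≤ r i) ∧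
      (∀ i, IsGenTri (s i) (s (i + 1)) (L i)) ∧ (∀ i, 0 ≤ starConvexity L s i) ∧
      ∑ i, triAngle (r i) (r (i + 1)) (L i) < ∑ i, triAngle (s i) (s (i + 1)) (L i) := by
  have : Fact (1 < n) := ⟨by omega⟩
  have hL : ∀ i, 0 < L i := fun i => (hr i).2.2.1
  have hρ0 : ∀ i, 0 < ρ i := fun i => (hρ i).1
  have hr0 : ∀ i, 0 < r i := fun i => (hr i).1
  obtain ⟨i, hi, hpos⟩ := exists_lt_and_starConvexity_pos hL hρ0 hρr hρconv hlt
  have hne₁ : i + 1 ≠ i := by simp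
  have hne₂ : i - 1 ≠ i := by simp [sub_eq_self]
  have t₁ := hr i
  have t₂ := hr (i - 1)
  have u₁ := hρ i
  have u₂ := hρ (i - 1)
  rw [sub_add_cancel] at t₂ u₂
  unfold starConvexity at hpos
  have hcos : ∀ {l q l' q' : ℝ}, 0 < l → 0 < q → 0 < l' → q' ≤ r i + l' → r i ≤ q' + l' →
      l' ≤ r i + q' →
      0 < (r i ^ 2 + l ^ 2 - q ^ 2) / l + (r i ^ 2 + l' ^ 2 - q' ^ 2) / l' → q < r i + l := by
    intro l q l' q' hl hq hl' h₁ h₂ h₃ h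
    by_contra! hcon
    have e₁ : (r i ^ 2 + l ^ 2 - q ^ 2) / l ≤ -(2 * r i) := by
      rw [div_le_iff₀ hl]
      nlinarith [hr0 i]
    have e₂ : (r i ^ 2 + l' ^ 2 - q' ^ 2) / l' ≤ 2 * r i := by
      rw [div_le_iff₀ hl']
      nlinarith [hr0 i]
    linarith
  have hA₁ : r (i + 1) < r i + L i := hcos (hL _) (hr0 _) (hL (i - 1)) (q' := r (i - 1))
    (by linarith [t₂.2.2.2.1]) (by linarith [t₂.2.2.2.2.1]) (by linarith [t₂.2.2.2.2.2]) hpos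
  have hA₂ : r (i - 1) < r i + L (i - 1) := hcos (hL _) (hr0 _) (hL i) (q' := r (i + 1))
    (by linarith [t₁.2.2.2.2.1]) (by linarith [t₁.2.2.2.1]) (by linarith [t₁.2.2.2.2.2])
    (by rwa [add_comm] at hpos)
  obtain ⟨a, hca, hab, a₁, a₂, a₃, a₄, a₅⟩ := exists_shorter_spoke hi hA₁ hA₂
    (by linarith [u₁.2.2.2.2.2, hρr (i + 1)]) (by linarith [u₂.2.2.2.2.2, hρr (i - 1)]) hpos
  have ha : 0 < a := (hρ0 i).trans hca
  have hangle := triAngle_add_lt_of_shorten ha hab (hr0 (i + 1)) (hL i) (hr0 (i - 1)) (hL (i - 1))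
    t₁.2.2.2.1 t₂.2.2.2.2.1 a₁ a₂ a₃ a₄ a₅
  obtain ⟨s, hs⟩ : ∃ s, s = Function.update r i a := ⟨_, rfl⟩
  have hsi : s i = a := by simp [hs]
  have hsj : ∀ j, j ≠ i → s j = r j := fun j hj => by simp [hs, hj]
  have hs0 : ∀ j, 0 < s j := by
    intro j
    by_cases hj : j = i
    · rw [hj, hsi]; exact ha
    · rw [hsj j hj]; exact hr0 j
  have hsr : ∀ j, s j ≤ r j := by
    intro j
    by_cases hj : j = i
    · rw [hj, hsi]; exact hab.le
    · rw [hsj j hj]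
  refine ⟨s, ?_, hsr, ?_, ?_, ?_⟩
  · intro j
    by_cases hj : j = i
    · rw [hj, hsi]; exact hca.le
    · rw [hsj j hj]; exact hρr j
  · intro j
    by_cases hj : j = i
    · rw [hj, hsi, hsj _ hne₁]
      exact ⟨ha, hr0 _, hL _, by linarith [t₁.2.2.2.1], a₁.le, a₃.le⟩
    by_cases hj' : j + 1 = i
    · obtain rfl : j = i - 1 := eq_sub_of_add_eq hj'
      rw [sub_add_cancel, hsi, hsj _ hne₂]
      exact ⟨hr0 _, ha, hL _, a₂.le, by linarith [t₂.2.2.2.2.1], by linarith⟩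
    · rw [hsj _ hj, hsj _ hj']
      exact hr j
  · intro j
    by_cases hj : j = i
    · subst hj
      unfold starConvexity
      rw [hsi, hsj _ hne₁, hsj _ hne₂]
      exact a₅.le
    · refine (hrconv j).trans ?_
      unfold starConvexity
      rw [hsj j hj]
      have := (hL j).le
      have := (hL (j - 1)).le
      gcongr
      · exact (hs0 _).le
      · exact hsr _
      · exact (hs0 _).le
      · exact hsr _
  · have hmem : i - 1 ∈ Finset.univ.erase i := by simp [hne₂]
    have hrest : ∑ j ∈ (Finset.univ.erase i).erase (i - 1), triAngle (s j) (s (j + 1)) (L j) =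
        ∑ j ∈ (Finset.univ.erase i).erase (i - 1), triAngle (r j) (r (j + 1)) (L j) := by
      refine Finset.sum_congr rfl fun j hj => ?_
      simp only [Finset.mem_erase, Finset.mem_univ, and_true] at hj
      rw [hsj j hj.2, hsj (j + 1) fun h => hj.1 (eq_sub_of_add_eq h)]
    rw [← Finset.add_sum_erase _ _ (Finset.mem_univ i), ← Finset.add_sum_erase _ _ hmem,
      ← Finset.add_sum_erase _ (fun j => triAngle (s j) (s (j + 1)) (L j)) (Finset.mem_univ i),
      ← Finset.add_sum_erase _ (fun j => triAngle (s j) (s (j + 1)) (L j)) hmem, hrest,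
      sub_add_cancel, hsi, hsj _ hne₁, hsj _ hne₂, triAngle_comm (r (i - 1)),
      triAngle_comm (r (i - 1))]
    linarith

/-- Inverted spoke lengths of the scaled metric. -/
noncomputable def invSpoke (n : ℕ) (x : ZMod n → ℝ) (w0 : ℝ) (w : ZMod n → ℝ) (i : ZMod n) : ℝ :=
  Real.exp (w0 - w i) / x i

/-- Inverted boundary edge lengths; these do not depend on the conformal factor. -/
noncomputable def invEdge (n : ℕ) (x y : ZMod n → ℝ) (i : ZMod n) : ℝ :=
  y i / (x i * x (i + 1))

lemma exists_inversion_factor {n : ℕ} {x : ZMod n → ℝ} (hx : ∀ i, 0 < x i) (y : ZMod n → ℝ)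
    (w0 : ℝ) (w : ZMod n → ℝ) (i : ZMod n) :
    ∃ k : ℝ, 0 < k ∧ Xl n x w0 w i = k * invSpoke n x w0 w (i + 1) ∧
      Xl n x w0 w (i + 1) = k * invSpoke n x w0 w i ∧ Yl n y w i = k * invEdge n x y i := by
  have h₁ := hx i
  have h₂ := hx (i + 1)
  refine ⟨Real.exp (w i + w (i + 1)) * (x i * x (i + 1)), by positivity, ?_, ?_, ?_⟩
  · unfold Xl invSpoke
    rw [show w0 + w i = (w i + w (i + 1)) + (w0 - w (i + 1)) by ring, Real.exp_add]
    field_simp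
  · unfold Xl invSpoke
    rw [show w0 + w (i + 1) = (w i + w (i + 1)) + (w0 - w i) by ring, Real.exp_add]
    field_simp
  · unfold Yl invEdge
    field_simp

lemma isGenTri_iff_inv {n : ℕ} {x : ZMod n → ℝ} (hx : ∀ i, 0 < x i) (y : ZMod n → ℝ)
    (w0 : ℝ) (w : ZMod n → ℝ) (i : ZMod n) :
    IsGenTri (Xl n x w0 w i) (Xl n x w0 w (i + 1)) (Yl n y w i) ↔
      IsGenTri (invSpoke n x w0 w i) (invSpoke n x w0 w (i + 1)) (invEdge n x y i) := by
  obtain ⟨k, hk, h₁, h₂, h₃⟩ := exists_inversion_factor hx y w0 w i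
  rw [h₁, h₂, h₃, isGenTri_mul_iff hk]
  exact ⟨IsGenTri.swap, IsGenTri.swap⟩

lemma coneAngle_eq_inv {n : ℕ} [NeZero n] {x : ZMod n → ℝ} (hx : ∀ i, 0 < x i) (y : ZMod n → ℝ)
    (w0 : ℝ) (w : ZMod n → ℝ) :
    coneAngle n x y w0 w =
      ∑ i, triAngle (invSpoke n x w0 w i) (invSpoke n x w0 w (i + 1)) (invEdge n x y i) := by
  refine Finset.sum_congr rfl fun i _ => ?_
  obtain ⟨k, hk, h₁, h₂, h₃⟩ := exists_inversion_factor hx y w0 w i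
  rw [cAng, h₁, h₂, h₃, triAngle_mul hk.ne', triAngle_comm]

lemma delaunay_iff_starConvexity {n : ℕ} {x : ZMod n → ℝ} (hx : ∀ i, 0 < x i) (y : ZMod n → ℝ)
    (w0 : ℝ) (w : ZMod n → ℝ)
    (htri : ∀ i, IsGenTri (invSpoke n x w0 w i) (invSpoke n x w0 w (i + 1)) (invEdge n x y i))
    (i : ZMod n) :
    aAng n x y w0 w i + bAng n x y w0 w i ≤ π ↔
      0 ≤ starConvexity (invEdge n x y) (invSpoke n x w0 w) i := by
  have ha : aAng n x y w0 w i =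
      triAngle (invSpoke n x w0 w i) (invEdge n x y i) (invSpoke n x w0 w (i + 1)) := by
    obtain ⟨k, hk, h₁, h₂, h₃⟩ := exists_inversion_factor hx y w0 w i
    rw [aAng, h₁, h₂, h₃, triAngle_mul hk.ne']
  have hb : bAng n x y w0 w i =
      triAngle (invSpoke n x w0 w i) (invEdge n x y (i - 1)) (invSpoke n x w0 w (i - 1)) := by
    obtain ⟨k, hk, h₁, h₂, h₃⟩ := exists_inversion_factor hx y w0 w (i - 1)
    rw [sub_add_cancel] at h₁ h₂
    rw [bAng, h₁, h₂, h₃, triAngle_mul hk.ne']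
  have t := htri (i - 1)
  rw [sub_add_cancel] at t
  rw [ha, hb]
  exact triAngle_add_le_pi_iff (htri i).swap.rotate t.rotate

/-- (Key Lemma 3.2.)  Under the hypotheses of the maximum principle, if moreover some
`w_{i₀} < w₀`, then there is `wHat` with `w ≤ wHat ≤ w₀` (pointwise) such that the metric
scaled by `(w₀, wHat)` is a generalized Delaunay PL metric and its cone angle at `v₀`
is strictly larger than that of the metric scaled by `(w₀, w)`. -/
theorem star_key_lemma
    (n : ℕ) [NeZero n] (hn : 3 ≤ n) (x y : ZMod n → ℝ)
    (hbase : ∀ i : ZMod n, IsGenTri (x i) (x (i + 1)) (y i))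
    (hbaseDel : ∀ i : ZMod n, aAng n x y 0 0 i + bAng n x y 0 0 i ≤ π)
    (w0 : ℝ) (w : ZMod n → ℝ)
    (htri : ∀ i : ZMod n,
      IsGenTri (Xl n x w0 w i) (Xl n x w0 w (i + 1)) (Yl n y w i))
    (hDel : ∀ i : ZMod n, aAng n x y w0 w i + bAng n x y w0 w i ≤ π)
    (hα : coneAngle n x y 0 0 ≤ coneAngle n x y w0 w)
    (hmax : ∀ i : ZMod n, w i ≤ w0)
    (hlt : ∃ i₀ : ZMod n, w i₀ < w0) :
    ∃ wHat : ZMod n → ℝ,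
      (∀ i : ZMod n, w i ≤ wHat i) ∧
      (∀ i : ZMod n, wHat i ≤ w0) ∧
      (∀ i : ZMod n,
        IsGenTri (Xl n x w0 wHat i) (Xl n x w0 wHat (i + 1)) (Yl n y wHat i)) ∧
      (∀ i : ZMod n, aAng n x y w0 wHat i + bAng n x y w0 wHat i ≤ π) ∧
      coneAngle n x y w0 w < coneAngle n x y w0 wHat := by
  have hx : ∀ i, 0 < x i := fun i => (hbase i).1
  have hρtri : ∀ i,
      IsGenTri (invSpoke n x 0 0 i) (invSpoke n x 0 0 (i + 1)) (invEdge n x y i) := fun i =>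
    (isGenTri_iff_inv hx y 0 0 i).1 (by simpa [Xl, Yl] using hbase i)
  have hrtri := fun i => (isGenTri_iff_inv hx y w0 w i).1 (htri i)
  have hρ : ∀ i, invSpoke n x 0 0 i = 1 / x i := fun i => by simp [invSpoke]
  obtain ⟨s, hs₁, hs₂, hs₃, hs₄, hs₅⟩ := exists_shorter_star_coneAngle_lt hn hρtri hrtri
    (fun i => by
      rw [hρ, invSpoke]
      exact div_le_div_of_nonneg_right (Real.one_le_exp (by linarith [hmax i])) (hx i).le)
    (fun i => (delaunay_iff_starConvexity hx y 0 0 hρtri i).1 (hbaseDel i))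
    (fun i => (delaunay_iff_starConvexity hx y w0 w hrtri i).1 (hDel i))
    (by
      obtain ⟨i, hi⟩ := hlt
      refine ⟨i, ?_⟩
      rw [hρ, invSpoke]
      exact div_lt_div_of_pos_right (Real.one_lt_exp_iff.2 (by linarith)) (hx i))
  have hsx : ∀ i, 1 ≤ s i * x i := fun i => by
    have h := hs₁ i
    rwa [hρ, div_le_iff₀ (hx i)] at h
  have hinv : invSpoke n x w0 (fun i => w0 - Real.log (s i * x i)) = s := by
    funext i
    rw [invSpoke, sub_sub_cancel, Real.exp_log (by linarith [hsx i]),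
      mul_div_cancel_right₀ _ (hx i).ne']
  refine ⟨fun i => w0 - Real.log (s i * x i), fun i => ?_, fun i => ?_, fun i => ?_, fun i => ?_,
    ?_⟩
  · have h := hs₂ i
    rw [invSpoke, le_div_iff₀ (hx i)] at h
    have := (Real.log_le_iff_le_exp (by linarith [hsx i])).2 h
    linarith
  · linarith [Real.log_nonneg (hsx i)]
  · rw [isGenTri_iff_inv hx, hinv]
    exact hs₃ i
  · rw [delaunay_iff_starConvexity hx y w0 _ (by rwa [hinv]), hinv]
    exact hs₄ i
  · rw [coneAngle_eq_inv hx, coneAngle_eq_inv hx, hinv]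
    exact hs₅
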